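/- arXiv:2207.09256 — 2 statements merged into one kernel-verified Lean document; each statement's English description precedes it below -/
import Mathlib

section
/- Let A be a Dirac ring and let 𝔪 ⊆ A be a maximal graded ideal. Then 𝔪 is a prime ideal of A: 𝔪 ≠ A and for all x, y ∈ A, x·y ∈ 𝔪 implies x ∈ 𝔪 or y ∈ 𝔪. -/
/-- A Dirac ring: a `ℤ`-graded ring satisfying the Koszul sign rule. -/
class DiracRing {A : Type*} [Ring A] (𝒜 : ℤ → AddSubgroup A) extends GradedRing 𝒜 where
  koszul : ∀ {i j : ℤ} {a b : A}, a ∈ 𝒜 i → b ∈ 𝒜 j →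
    a * b = (((-1 : ℤˣ) ^ (i * j) : ℤˣ) : ℤ) • (b * a)

/-- A graded ideal: a (left) ideal closed under taking homogeneous components. -/
def Ideal.IsDiracGraded {A : Type*} [Ring A] (𝒜 : ℤ → AddSubgroup A) [DiracRing 𝒜]
    (I : Ideal A) : Prop :=
  ∀ x ∈ I, ∀ k : ℤ, ((DirectSum.decompose 𝒜 x) k : A) ∈ I

open DirectSum in
/-- A graded left ideal of a Dirac ring is also closed under right multiplication. -/
theorem Ideal.IsDiracGraded.mul_mem_right {A : Type*} [Ring A] {𝒜 : ℤ → AddSubgroup A}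
    [DiracRing 𝒜] {I : Ideal A} (hI : Ideal.IsDiracGraded 𝒜 I) {x : A} (b : A) (hx : x ∈ I) :
    x * b ∈ I := by
  classical
  rw [← DirectSum.sum_support_decompose 𝒜 x, ← DirectSum.sum_support_decompose 𝒜 b,
    Finset.sum_mul_sum]
  refine I.sum_mem fun i _ => I.sum_mem fun j _ => ?_
  rw [DiracRing.koszul (SetLike.coe_mem (decompose 𝒜 x i)) (SetLike.coe_mem (decompose 𝒜 b j))]
  exact zsmul_mem (I.mul_mem_left _ (hI x hx i)) _

/-- A maximal graded ideal of a Dirac ring satisfies the primality condition on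
homogeneous elements. -/
theorem Ideal.IsDiracGraded.mem_or_mem_of_isHomogeneousElem {A : Type*} [Ring A]
    {𝒜 : ℤ → AddSubgroup A} [DiracRing 𝒜] {m : Ideal A} (hgr : Ideal.IsDiracGraded 𝒜 m)
    (hmax : ∀ J : Ideal A, Ideal.IsDiracGraded 𝒜 J → J ≠ ⊤ → m ≤ J → J = m)
    {a b : A} (ha : SetLike.IsHomogeneousElem 𝒜 a) (hab : a * b ∈ m) : a ∈ m ∨ b ∈ m := by
  by_cases htop : m ⊔ Ideal.span {a} = ⊤
  · right
    have h1 : (1 : A) ∈ m ⊔ Ideal.span {a} := htop ▸ Submodule.mem_top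
    obtain ⟨y, hy, z, hz, hyz⟩ := Submodule.mem_sup.1 h1
    obtain ⟨r, rfl⟩ := Submodule.mem_span_singleton.1 hz
    rw [← one_mul b, ← hyz, add_mul, smul_eq_mul, mul_assoc]
    exact m.add_mem (hgr.mul_mem_right b hy) (m.mul_mem_left r hab)
  · left
    have hm : m.IsHomogeneous 𝒜 := fun i x hx => hgr x hx i
    have hspan : (Ideal.span {a}).IsHomogeneous 𝒜 :=
      Ideal.homogeneous_span 𝒜 _ fun x hx => Set.mem_singleton_iff.1 hx ▸ ha
    rw [← hmax _ (fun x hx i => (hm.sup hspan) i hx) htop le_sup_left]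
    exact Ideal.mem_sup_right (Ideal.mem_span_singleton_self a)

open DirectSum in
/-- If an element lies outside a graded ideal, it has a component of highest degree
outside that ideal. -/
theorem Ideal.exists_decompose_notMem_forall_lt {A : Type*} [Ring A] (𝒜 : ℤ → AddSubgroup A)
    [GradedRing 𝒜] {I : Ideal A} {x : A} (hx : x ∉ I) :
    ∃ p : ℤ, (decompose 𝒜 x p : A) ∉ I ∧ ∀ i, p < i → (decompose 𝒜 x i : A) ∈ I := by
  classical
  let s := (decompose 𝒜 x).support.filter fun i => (decompose 𝒜 x i : A) ∉ I
  have hs : s.Nonempty := by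
    by_contra! h
    refine hx ?_
    rw [← DirectSum.sum_support_decompose 𝒜 x]
    refine I.sum_mem fun i hi => ?_
    by_contra hmem
    exact Finset.notMem_empty i (h ▸ Finset.mem_filter.2 ⟨hi, hmem⟩)
  refine ⟨s.max' hs, (Finset.mem_filter.1 (s.max'_mem hs)).2, fun i hi => ?_⟩
  by_contra hmem
  refine hi.not_ge (s.le_max' i (Finset.mem_filter.2 ⟨?_, hmem⟩))
  rw [DFinsupp.mem_support_iff]
  intro h0
  exact hmem (by simp [h0])

/-- a maximal graded ideal of a Dirac ring is a prime ideal. -/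
theorem dirac_maximal_graded_ideal_is_prime
    {A : Type*} [Ring A] (𝒜 : ℤ → AddSubgroup A) [DiracRing 𝒜]
    (m : Ideal A) (hgr : Ideal.IsDiracGraded 𝒜 m) (hne : m ≠ ⊤)
    (hmax : ∀ J : Ideal A, Ideal.IsDiracGraded 𝒜 J → J ≠ ⊤ → m ≤ J → J = m) :
    m ≠ ⊤ ∧ ∀ x y : A, x * y ∈ m → x ∈ m ∨ y ∈ m := by
  classical
  refine ⟨hne, fun x y hxy => ?_⟩
  by_contra! h
  obtain ⟨p, hp, hp'⟩ := Ideal.exists_decompose_notMem_forall_lt 𝒜 h.1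
  obtain ⟨q, hq, hq'⟩ := Ideal.exists_decompose_notMem_forall_lt 𝒜 h.2
  have hpq := hgr _ hxy (p + q)
  rw [DirectSum.decompose_mul, DirectSum.coe_mul_apply] at hpq
  have hmem : (p, q) ∈ ((DirectSum.decompose 𝒜 x).support ×ˢ (DirectSum.decompose 𝒜 y).support).filter
      fun ij : ℤ × ℤ => ij.1 + ij.2 = p + q := by
    simp only [Finset.mem_filter, Finset.mem_product, DFinsupp.mem_support_iff, and_true]
    exact ⟨fun h0 => hp (by simp [h0]), fun h0 => hq (by simp [h0])⟩
  rw [← Finset.add_sum_erase _ _ hmem] at hpq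
  refine (hgr.mem_or_mem_of_isHomogeneousElem hmax ⟨p, SetLike.coe_mem _⟩
    ((Submodule.add_mem_iff_left m (m.sum_mem ?_)).1 hpq)).elim hp hq
  rintro ⟨i, j⟩ hij
  obtain ⟨hij_ne, hij⟩ := Finset.mem_erase.1 hij
  have hsum : i + j = p + q := (Finset.mem_filter.1 hij).2
  rcases lt_trichotomy p i with hi | rfl | hi
  · exact hgr.mul_mem_right _ (hp' i hi)
  · exact absurd (congrArg (Prod.mk p) (add_left_cancel hsum)) hij_ne
  · exact m.mul_mem_left _ (hq' j (by lia))
end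

section
/- Let φ : A → B be a map of Dirac rings. If y₁, y₂ ∈ B are homogeneous elements that are integral over A, then the product y₁·y₂ is integral over A, and if moreover deg(y₁) = deg(y₂), then the sum y₁ + y₂ is integral over A. -/
/-- A map of Dirac rings: a ring homomorphism preserving the grading. -/
def IsDiracHom {A B : Type*} [Ring A] [Ring B]
    (𝒜 : ℤ → AddSubgroup A) (ℬ : ℤ → AddSubgroup B) (f : A →+* B) : Prop :=
  ∀ k : ℤ, ∀ a ∈ 𝒜 k, f a ∈ ℬ k

/-- A homogeneous element `y` of degree `e` of a Dirac `A`-algebra is integral over `A`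
if it is a root of a monic homogeneous polynomial: there are `n ≥ 1` and homogeneous
`a_i ∈ A` of degree `(n - i)·e` with `yⁿ + φ(a_{n-1})·y^{n-1} + ⋯ + φ(a_0) = 0`. -/
def DiracIntegralAt {A B : Type*} [Ring A] [Ring B]
    (𝒜 : ℤ → AddSubgroup A) (φ : A →+* B) (e : ℤ) (y : B) : Prop :=
  ∃ n : ℕ, 1 ≤ n ∧ ∃ a : ℕ → A,
    (∀ i < n, a i ∈ 𝒜 (((n : ℤ) - (i : ℤ)) * e)) ∧
    y ^ n + ∑ i ∈ Finset.range n, φ (a i) * y ^ i = 0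

open Polynomial DirectSum

theorem DiracRing.mul_eq_of_even {A : Type*} [Ring A] (𝒜 : ℤ → AddSubgroup A) [DiracRing 𝒜]
    {i j : ℤ} (hij : Even (i * j)) {a b : A} (ha : a ∈ 𝒜 i) (hb : b ∈ 𝒜 j) :
    a * b = b * a := by
  rw [DiracRing.koszul ha hb, hij.neg_one_zpow]
  simp

theorem DiracRing.mul_eq_neg_of_odd {A : Type*} [Ring A] (𝒜 : ℤ → AddSubgroup A) [DiracRing 𝒜]
    {i j : ℤ} (hij : Odd (i * j)) {a b : A} (ha : a ∈ 𝒜 i) (hb : b ∈ 𝒜 j) :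
    a * b = -(b * a) := by
  rw [DiracRing.koszul ha hb, hij.neg_one_zpow]
  simp

theorem DiracRing.mem_center_of_even {A : Type*} [Ring A] (𝒜 : ℤ → AddSubgroup A) [DiracRing 𝒜]
    {i : ℤ} (hi : Even i) {a : A} (ha : a ∈ 𝒜 i) : a ∈ Subring.center A := by
  rw [Subring.mem_center_iff]
  intro b
  induction b using DirectSum.Decomposition.inductionOn 𝒜 with
  | zero => simp
  | homogeneous b => exact (mul_eq_of_even 𝒜 (hi.mul_right _) ha b.2).symm
  | add b c hb hc => rw [add_mul, mul_add, hb, hc]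

theorem IsDiracHom.map_coe_decompose {A B : Type*} [Ring A] [Ring B]
    {𝒜 : ℤ → AddSubgroup A} {ℬ : ℤ → AddSubgroup B} [DiracRing 𝒜] [DiracRing ℬ]
    {φ : A →+* B} (hφ : IsDiracHom 𝒜 ℬ φ) (k : ℤ) (a : A) :
    φ (decompose 𝒜 a k) = decompose ℬ (φ a) k := by
  induction a using DirectSum.Decomposition.inductionOn 𝒜 with
  | zero => simp
  | @homogeneous i b =>
    by_cases h : i = k
    · subst h
      rw [decompose_of_mem_same 𝒜 b.2, decompose_of_mem_same ℬ (hφ _ _ b.2)]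
    · rw [decompose_of_mem_ne 𝒜 b.2 h, decompose_of_mem_ne ℬ (hφ _ _ b.2) h, map_zero]
  | add b c hb hc => simp [decompose_add, hb, hc]

/-- The coefficients of a monic equation for a homogeneous element may be replaced by their
homogeneous components of the appropriate degrees. -/
theorem DiracIntegralAt.of_eq_zero {A B : Type*} [Ring A] [Ring B]
    {𝒜 : ℤ → AddSubgroup A} {ℬ : ℤ → AddSubgroup B} [DiracRing 𝒜] [DiracRing ℬ]
    {φ : A →+* B} (hφ : IsDiracHom 𝒜 ℬ φ) {e : ℤ} {y : B} (hy : y ∈ ℬ e)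
    {n : ℕ} (hn : 1 ≤ n) (a : ℕ → A)
    (h : y ^ n + ∑ i ∈ Finset.range n, φ (a i) * y ^ i = 0) :
    DiracIntegralAt 𝒜 φ e y := by
  have hpow (i : ℕ) : y ^ i ∈ ℬ (i * e) := by
    simpa using SetLike.pow_mem_graded i hy
  refine ⟨n, hn, fun i => decompose 𝒜 (a i) ((n - i) * e), fun i _ => SetLike.coe_mem _, ?_⟩
  have key := congrArg (GradedRing.proj ℬ (n * e)) h
  rw [map_add, map_zero, map_sum, GradedRing.proj_apply,
    decompose_of_mem_same ℬ (hpow n)] at key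
  rw [← key]
  congr 1
  refine Finset.sum_congr rfl fun i _ => ?_
  rw [GradedRing.proj_apply, hφ.map_coe_decompose,
    ← coe_decompose_mul_add_of_right_mem ℬ (hpow i), ← add_mul, sub_add_cancel]

theorem DiracIntegralAt.of_isIntegralElem {A B R : Type*} [Ring A] [Ring B] [CommRing R]
    {𝒜 : ℤ → AddSubgroup A} {ℬ : ℤ → AddSubgroup B} [DiracRing 𝒜] [DiracRing ℬ]
    {φ : A →+* B} (hφ : IsDiracHom 𝒜 ℬ φ) (ι : R →+* A) {e : ℤ} {y : B} (hy : y ∈ ℬ e)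
    (h : (φ.comp ι).IsIntegralElem y) : DiracIntegralAt 𝒜 φ e y := by
  obtain ⟨p, hp, hpy⟩ := h
  have hy0 : y ^ p.natDegree +
      ∑ i ∈ Finset.range p.natDegree, φ (ι (p.coeff i)) * y ^ i = 0 := by
    rw [eval₂_eq_sum_range, Finset.sum_range_succ, hp.coeff_natDegree] at hpy
    simpa [add_comm] using hpy
  refine .of_eq_zero hφ hy (n := p.natDegree + 1) (by simp)
    (fun i => if i = 0 then 0 else ι (p.coeff (i - 1))) ?_
  rw [Finset.sum_range_succ']
  simp only [Nat.add_eq_zero_iff, one_ne_zero, and_false, if_false, if_true, map_zero, zero_mul,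
    add_zero, Nat.add_sub_cancel, pow_succ, ← mul_assoc]
  rw [← Finset.sum_mul, ← add_mul, hy0, zero_mul]

theorem RingHom.isIntegralElem_of_sq_add_eq_zero {R S : Type*} [CommRing R] [CommRing S]
    (f : R →+* S) (z : S) (m : ℕ) (c : ℕ → R) (r : ℕ → ℕ → R)
    (h : (z ^ m + ∑ j ∈ Finset.range m, f (c j) * z ^ j) ^ 2 +
      ∑ j ∈ Finset.range m, ∑ k ∈ Finset.range m, f (r j k) * z ^ (j + k + 1) = 0) :
    f.IsIntegralElem z := by
  have hdeg : degree (∑ j ∈ Finset.range m, C (c j) * X ^ j) < m := by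
    rw [← mem_degreeLT]
    refine sum_mem fun j hj => mem_degreeLT.2 ((degree_C_mul_X_pow_le _ _).trans_lt ?_)
    exact_mod_cast Finset.mem_range.1 hj
  have hmonic := monic_X_pow_add hdeg
  refine ⟨(X ^ m + ∑ j ∈ Finset.range m, C (c j) * X ^ j) ^ 2 +
    ∑ j ∈ Finset.range m, ∑ k ∈ Finset.range m, C (r j k) * X ^ (j + k + 1), ?_, ?_⟩
  · nontriviality R
    refine (hmonic.pow 2).add_of_left ?_
    rw [degree_pow' (by simp [hmonic.leadingCoeff]), degree_add_eq_left_of_degree_lt (by rwa [degree_X_pow]),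
      degree_X_pow, nsmul_eq_mul, ← Nat.cast_mul, ← mem_degreeLT]
    refine sum_mem fun j hj => sum_mem fun k hk =>
      mem_degreeLT.2 ((degree_C_mul_X_pow_le _ _).trans_lt ?_)
    have := Finset.mem_range.1 hj
    have := Finset.mem_range.1 hk
    exact_mod_cast (by omega : j + k + 1 < 2 * m)
  · simpa [eval₂_finsetSum, eval₂_pow] using h

/-- The central elements of `A` that `φ` sends to central elements of `B`. -/
def biCenter {A B : Type*} [Ring A] [Ring B] (φ : A →+* B) : Subring (Subring.center A) :=
  (Subring.center B).comap (φ.comp (Subring.center A).subtype)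

/-- The restriction of `φ` to central elements. -/
def biCenterHom {A B : Type*} [Ring A] [Ring B] (φ : A →+* B) :
    biCenter φ →+* Subring.center B :=
  (φ.comp ((Subring.center A).subtype.comp (biCenter φ).subtype)).codRestrict _ fun x => x.2

theorem IsDiracHom.exists_biCenterHom_eq {A B : Type*} [Ring A] [Ring B]
    {𝒜 : ℤ → AddSubgroup A} {ℬ : ℤ → AddSubgroup B} [DiracRing 𝒜] [DiracRing ℬ]
    {φ : A →+* B} (hφ : IsDiracHom 𝒜 ℬ φ) {i : ℤ} (hi : Even i) {a : A} (ha : a ∈ 𝒜 i) :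
    ∃ r : biCenter φ, (biCenterHom φ r : B) = φ a :=
  ⟨⟨⟨a, DiracRing.mem_center_of_even 𝒜 hi ha⟩,
    DiracRing.mem_center_of_even ℬ hi (hφ i a ha)⟩, rfl⟩

theorem DiracIntegralAt.of_isIntegralElem_biCenterHom {A B : Type*} [Ring A] [Ring B]
    {𝒜 : ℤ → AddSubgroup A} {ℬ : ℤ → AddSubgroup B} [DiracRing 𝒜] [DiracRing ℬ]
    {φ : A →+* B} (hφ : IsDiracHom 𝒜 ℬ φ) {e : ℤ} {y : B} (hy : y ∈ ℬ e)
    {z : Subring.center B} (hz : (biCenterHom φ).IsIntegralElem z) {k : ℕ} (hk : 0 < k)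
    (hzy : (z : B) = y ^ k) : DiracIntegralAt 𝒜 φ e y := by
  refine .of_isIntegralElem hφ ((Subring.center A).subtype.comp (biCenter φ).subtype) hy ?_
  let g : biCenter φ →+* B := (Subring.center B).subtype.comp (biCenterHom φ)
  let := g.toAlgebra' fun c x => (Subring.mem_center_iff.1 (biCenterHom φ c).2 x).symm
  have hzk : IsIntegral (biCenter φ) (y ^ k) := hzy ▸ hz.map (Subring.center B).subtype
  exact hzk.of_pow hk

theorem DiracIntegralAt.isIntegralElem_of_even {A B : Type*} [Ring A] [Ring B]
    {𝒜 : ℤ → AddSubgroup A} {ℬ : ℤ → AddSubgroup B} [DiracRing 𝒜] [DiracRing ℬ]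
    {φ : A →+* B} (hφ : IsDiracHom 𝒜 ℬ φ) {e : ℤ} (he : Even e) {z : Subring.center B}
    (h : DiracIntegralAt 𝒜 φ e z) : (biCenterHom φ).IsIntegralElem z := by
  obtain ⟨n, -, a, ha, h⟩ := h
  have hex (i : ℕ) : ∃ r : biCenter φ, i < n → (biCenterHom φ r : B) = φ (a i) := by
    by_cases hi : i < n
    · obtain ⟨r, hr⟩ := hφ.exists_biCenterHom_eq (he.mul_left _) (ha i hi)
      exact ⟨r, fun _ => hr⟩
    · exact ⟨0, fun h => absurd h hi⟩
  choose c hc using hex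
  have hz : z ^ n + ∑ i ∈ Finset.range n, biCenterHom φ (c i) * z ^ i = 0 := by
    apply Subtype.ext
    push_cast
    rw [← h]
    congr 1
    exact Finset.sum_congr rfl fun i hi => by rw [hc i (Finset.mem_range.1 hi)]
  exact (biCenterHom φ).isIntegralElem_of_sq_add_eq_zero z n c 0 (by simp [hz])

/-- An even-length form of the integral equation, split into its even and odd parts. -/
theorem DiracIntegralAt.exists_even_odd {A B : Type*} [Ring A] [Ring B]
    {𝒜 : ℤ → AddSubgroup A} {φ : A →+* B} {e : ℤ} {y : B}
    (h : DiracIntegralAt 𝒜 φ e y) :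
    ∃ (m : ℕ) (a b : ℕ → A), (∀ j < m, a j ∈ 𝒜 (2 * (m - j) * e)) ∧
      (∀ j < m, b j ∈ 𝒜 ((2 * (m - j) - 1) * e)) ∧
      (y ^ 2) ^ m + ∑ j ∈ Finset.range m, φ (a j) * (y ^ 2) ^ j =
        -∑ j ∈ Finset.range m, φ (b j) * y * (y ^ 2) ^ j := by
  obtain ⟨n, -, a, ha, h⟩ := h
  let a' : ℕ → A := fun i => if i < n then 0 else a (i - n)
  have ha' (i : ℕ) (hi : i < 2 * n) : a' i ∈ 𝒜 ((2 * n - i) * e) := by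
    by_cases hin : i < n
    · simp [a', hin, zero_mem]
    · have := ha (i - n) (by omega)
      rw [Nat.cast_sub (by omega)] at this
      simp only [a', hin, if_false]
      convert this using 2
      ring
  have hsplit (g : ℕ → B) (m : ℕ) : ∑ i ∈ Finset.range (2 * m), g i =
      ∑ j ∈ Finset.range m, g (2 * j) + ∑ j ∈ Finset.range m, g (2 * j + 1) := by
    induction m with
    | zero => simp
    | succ m ih =>
      rw [mul_add, mul_one, Finset.sum_range_succ, Finset.sum_range_succ, ih,
        Finset.sum_range_succ, Finset.sum_range_succ]
      abel
  have h' : y ^ (2 * n) + ∑ i ∈ Finset.range (2 * n), φ (a' i) * y ^ i = 0 := by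
    have hlow : ∑ i ∈ Finset.range n, φ (a' i) * y ^ i = 0 :=
      Finset.sum_eq_zero fun i hi => by simp [a', Finset.mem_range.1 hi]
    rw [two_mul, Finset.sum_range_add, hlow, zero_add]
    simp only [a', add_lt_iff_neg_left, not_lt_zero, if_false, Nat.add_sub_cancel_left]
    calc _ = (y ^ n + ∑ i ∈ Finset.range n, φ (a i) * y ^ i) * y ^ n := by
          simp [add_mul, Finset.sum_mul, mul_assoc, ← pow_add, add_comm]
      _ = 0 := by rw [h, zero_mul]
  refine ⟨n, fun j => a' (2 * j), fun j => a' (2 * j + 1), fun j hj => ?_, fun j hj => ?_, ?_⟩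
  · convert ha' (2 * j) (by omega) using 2
    push_cast; ring
  · convert ha' (2 * j + 1) (by omega) using 2
    push_cast; ring
  · rw [hsplit, ← add_assoc] at h'
    rw [← pow_mul, eq_neg_iff_add_eq_zero, ← h']
    simp only [← pow_mul, pow_succ' y (2 * _), mul_assoc]

theorem DiracIntegralAt.isIntegralElem_sq {A B : Type*} [Ring A] [Ring B]
    {𝒜 : ℤ → AddSubgroup A} {ℬ : ℤ → AddSubgroup B} [DiracRing 𝒜] [DiracRing ℬ]
    {φ : A →+* B} (hφ : IsDiracHom 𝒜 ℬ φ) {e : ℤ} (he : Odd e) {y : B} (hy : y ∈ ℬ e)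
    {z : Subring.center B} (hz : (z : B) = y ^ 2)
    (h : DiracIntegralAt 𝒜 φ e y) : (biCenterHom φ).IsIntegralElem z := by
  obtain ⟨m, a, b, ha, hb, h⟩ := h.exists_even_odd
  have hodd (j : ℕ) : Odd ((2 * ((m : ℤ) - j) - 1) * e) :=
    (Even.sub_odd (even_two_mul _) odd_one).mul he
  have hex (j : ℕ) : ∃ r : biCenter φ, j < m → (biCenterHom φ r : B) = φ (a j) := by
    by_cases hj : j < m
    · obtain ⟨r, hr⟩ := hφ.exists_biCenterHom_eq
        (by rw [mul_assoc]; exact even_two_mul _) (ha j hj)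
      exact ⟨r, fun _ => hr⟩
    · exact ⟨0, fun h => absurd h hj⟩
  have hex' (j k : ℕ) : ∃ r : biCenter φ, j < m → k < m →
      (biCenterHom φ r : B) = φ (b j * b k) := by
    by_cases hjk : j < m ∧ k < m
    · obtain ⟨r, hr⟩ := hφ.exists_biCenterHom_eq ((hodd j).add_odd (hodd k))
        (SetLike.mul_mem_graded (hb j hjk.1) (hb k hjk.2))
      exact ⟨r, fun _ _ => hr⟩
    · exact ⟨0, fun h h' => absurd ⟨h, h'⟩ hjk⟩
  choose c hc using hex
  choose r hr using hex'
  refine (biCenterHom φ).isIntegralElem_of_sq_add_eq_zero z m c r (Subtype.ext ?_)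
  have hc' : ∑ j ∈ Finset.range m, (biCenterHom φ (c j) : B) * (y ^ 2) ^ j =
      ∑ j ∈ Finset.range m, φ (a j) * (y ^ 2) ^ j :=
    Finset.sum_congr rfl fun j hj => by rw [hc j (Finset.mem_range.1 hj)]
  push_cast
  rw [hz, hc', h, neg_sq, sq (Finset.sum _ _), Finset.sum_mul_sum, ← Finset.sum_add_distrib]
  refine Finset.sum_eq_zero fun j hj => ?_
  rw [← Finset.sum_add_distrib]
  refine Finset.sum_eq_zero fun k hk => ?_
  rw [Finset.mem_range] at hj hk
  have hanti := DiracRing.mul_eq_neg_of_odd ℬ (he.mul (hodd k)) hy (hφ _ _ (hb k hk))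
  have hcent (x : B) : (y ^ 2) ^ j * x = x * (y ^ 2) ^ j := by
    rw [← hz]
    exact (Subring.mem_center_iff.1 (pow_mem z.2 j) x).symm
  have hprod : φ (b j) * y * (y ^ 2) ^ j * (φ (b k) * y * (y ^ 2) ^ k) =
      φ (b j) * (y * φ (b k)) * y * ((y ^ 2) ^ k * (y ^ 2) ^ j) := by
    rw [mul_assoc (φ (b j) * y), hcent]
    simp only [mul_assoc]
  rw [hprod, hanti, hr j k hj hk, map_mul, ← pow_add, add_comm j k, pow_succ' (y ^ 2), sq y]
  simp only [mul_neg, neg_mul, mul_assoc]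
  exact neg_add_cancel _

/-- products of integral homogeneous elements are integral, and so are
sums of integral homogeneous elements of the same degree. -/
theorem dirac_integral_mul_and_add
    {A B : Type*} [Ring A] [Ring B]
    (𝒜 : ℤ → AddSubgroup A) (ℬ : ℤ → AddSubgroup B) [DiracRing 𝒜] [DiracRing ℬ]
    (φ : A →+* B) (hφ : IsDiracHom 𝒜 ℬ φ)
    (e₁ e₂ : ℤ) (y₁ y₂ : B) (h₁ : y₁ ∈ ℬ e₁) (h₂ : y₂ ∈ ℬ e₂)
    (hi₁ : DiracIntegralAt 𝒜 φ e₁ y₁) (hi₂ : DiracIntegralAt 𝒜 φ e₂ y₂) :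
    DiracIntegralAt 𝒜 φ (e₁ + e₂) (y₁ * y₂) ∧
    (e₁ = e₂ → DiracIntegralAt 𝒜 φ e₁ (y₁ + y₂)) := by
  have hsq {e : ℤ} {y : B} (hy : y ∈ ℬ e) : y ^ 2 ∈ Subring.center B :=
    DiracRing.mem_center_of_even ℬ (by simp) (SetLike.pow_mem_graded 2 hy)
  have hint {e : ℤ} {y : B} (hy : y ∈ ℬ e) (hi : DiracIntegralAt 𝒜 φ e y) :
      (biCenterHom φ).IsIntegralElem ⟨y ^ 2, hsq hy⟩ := by
    rcases Int.even_or_odd e with he | he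
    · have hz := DiracIntegralAt.isIntegralElem_of_even hφ he
        (z := ⟨y, DiracRing.mem_center_of_even ℬ he hy⟩) hi
      simpa [sq] using hz.mul (biCenterHom φ) hz
    · exact hi.isIntegralElem_sq hφ he hy rfl
  have hmul := (hint h₁ hi₁).mul (biCenterHom φ) (hint h₂ hi₂)
  refine ⟨?_, ?_⟩
  · have hy := SetLike.mul_mem_graded h₁ h₂
    rcases Int.even_or_odd (e₁ * e₂) with he | he
    · refine .of_isIntegralElem_biCenterHom hφ hy hmul two_pos ?_
      exact ((show Commute y₁ y₂ from DiracRing.mul_eq_of_even ℬ he h₁ h₂).mul_pow 2).symm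
    · refine .of_isIntegralElem_biCenterHom hφ hy (hmul.neg (biCenterHom φ)) two_pos ?_
      have hanti := DiracRing.mul_eq_neg_of_odd ℬ (mul_comm e₁ e₂ ▸ he) h₂ h₁
      calc -(y₁ ^ 2 * y₂ ^ 2) = y₁ * -(y₁ * y₂) * y₂ := by simp [sq, mul_assoc]
        _ = (y₁ * y₂) ^ 2 := by rw [← hanti]; simp [sq, mul_assoc]
  · rintro rfl
    have hy := add_mem h₁ h₂
    rcases Int.even_or_odd e₁ with he | he
    · have hz₁ := DiracIntegralAt.isIntegralElem_of_even hφ he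
        (z := ⟨y₁, DiracRing.mem_center_of_even ℬ he h₁⟩) hi₁
      have hz₂ := DiracIntegralAt.isIntegralElem_of_even hφ he
        (z := ⟨y₂, DiracRing.mem_center_of_even ℬ he h₂⟩) hi₂
      exact .of_isIntegralElem_biCenterHom hφ hy (hz₁.add (biCenterHom φ) hz₂) one_pos
        (pow_one _).symm
    · refine .of_isIntegralElem_biCenterHom hφ hy
        ((hint h₁ hi₁).add (biCenterHom φ) (hint h₂ hi₂)) two_pos ?_
      have hanti := DiracRing.mul_eq_neg_of_odd ℬ (he.mul he) h₁ h₂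
      change y₁ ^ 2 + y₂ ^ 2 = (y₁ + y₂) ^ 2
      rw [sq (y₁ + y₂), add_mul, mul_add, mul_add, hanti]
      noncomm_ring
end
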